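/- Let p, q > 2 and λ, γ > 0, and define for t ∈ ℝ with t > 1/2: I_{p,q,λ,γ}(t) := p + q − 1 − t²/(2t−1) + (2pq/(p+q)) ((γq/(λp))^{t+q−1} − 1) and I_{q,p,γ,λ}(t) := p + q − 1 − t²/(2t−1) + (2pq/(p+q)) ((λp/(γq))^{t+p−1} − 1). Set t₀ := max{t₊(p−1), t₊(q−1)}, where t₊(r) := r + √(r(r−1)). If I_{p,q,λ,γ}(t₀) > 0 and I_{q,p,γ,λ}(t₀) > 0, then the map t ↦ min{I_{p,q,λ,γ}(t), I_{q,p,γ,λ}(t)} is strictly decreasing on [t₀, ∞) and has a unique zero T in the open interval (t₀, ∞). -/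

import Mathlib

open Real Set

theorem sq_div_two_mul_sub_one_strictMonoOn :
    StrictMonoOn (fun t : ℝ => t ^ 2 / (2 * t - 1)) (Ici 1) := by
  intro x hx y hy hxy
  simp only [mem_Ici] at hx hy
  have hx' : 0 < 2 * x - 1 := by linarith
  have hy' : 0 < 2 * y - 1 := by linarith
  change x ^ 2 / (2 * x - 1) < y ^ 2 / (2 * y - 1)
  rw [div_lt_div_iff₀ hx' hy']
  have h : 0 < (y - x) * (2 * x * y - x - y) :=
    mul_pos (by linarith) (by nlinarith [mul_nonneg (sub_nonneg.2 hx) (sub_nonneg.2 hy)])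
  nlinarith

/-- A function `K - t² / (2t - 1) + c (a ^ (t + d) - 1)` with `0 < a ≤ 1` and `c ≥ 0` is strictly
decreasing on `[1, ∞)`. -/
theorem strictAntiOn_sub_sq_div_add_rpow {K c a : ℝ} (d : ℝ) (hc : 0 ≤ c) (ha : 0 < a)
    (ha1 : a ≤ 1) :
    StrictAntiOn (fun t : ℝ => K - t ^ 2 / (2 * t - 1) + c * (a ^ (t + d) - 1)) (Ici 1) := by
  intro x hx y hy hxy
  have h1 := sq_div_two_mul_sub_one_strictMonoOn hx hy hxy
  have h2 : c * a ^ (y + d) ≤ c * a ^ (x + d) :=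
    mul_le_mul_of_nonneg_left (rpow_le_rpow_of_exponent_ge ha ha1 (by linarith)) hc
  simp only at h1 ⊢
  linarith

theorem exists_zero_sub_sq_div_add_rpow {K c a d t₀ : ℝ} (hc : 0 ≤ c) (ha : 0 < a) (ha1 : a ≤ 1)
    (hd : 0 ≤ d) (ht₀ : 1 ≤ t₀)
    (hpos : 0 < K - t₀ ^ 2 / (2 * t₀ - 1) + c * (a ^ (t₀ + d) - 1)) :
    ∃ T, t₀ < T ∧ K - T ^ 2 / (2 * T - 1) + c * (a ^ (T + d) - 1) = 0 := by
  set f : ℝ → ℝ := fun t => K - t ^ 2 / (2 * t - 1) + c * (a ^ (t + d) - 1) with hf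
  set t₁ := t₀ + 2 * |K| with ht₁
  have h01 : t₀ ≤ t₁ := by linarith [abs_nonneg K]
  have hcont : ContinuousOn f (Icc t₀ t₁) := by
    have h1 : ContinuousOn (fun t : ℝ => t ^ 2 / (2 * t - 1)) (Icc t₀ t₁) :=
      ContinuousOn.div (by fun_prop) (by fun_prop) fun t ht => by linarith [ht.1]
    have h2 : Continuous fun t : ℝ => a ^ (t + d) :=
      continuous_const.rpow (by fun_prop) fun _ => Or.inl ha.ne'
    exact (continuousOn_const.sub h1).add
      (continuous_const.mul (h2.sub continuous_const)).continuousOn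
  have hneg : f t₁ < 0 := by
    have h1 : t₁ / 2 ≤ t₁ ^ 2 / (2 * t₁ - 1) := by
      rw [le_div_iff₀ (by linarith)]
      nlinarith
    have h2 : c * (a ^ (t₁ + d) - 1) ≤ 0 :=
      mul_nonpos_of_nonneg_of_nonpos hc
        (sub_nonpos.2 (rpow_le_one ha.le ha1 (by linarith)))
    simp only [hf]
    linarith [le_abs_self K]
  obtain ⟨T, hT, hT0⟩ := intermediate_value_Icc' h01 hcont ⟨hneg.le, hpos.le⟩
  refine ⟨T, lt_of_le_of_ne hT.1 ?_, hT0⟩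
  rintro rfl
  exact hpos.ne' hT0

/-- If `0 < a ≤ 1`, the minimum of the functions with bases `a` and `a⁻¹` is the one with
base `a`, which is strictly decreasing with a unique zero beyond `t₀`. -/
theorem min_strictAntiOn_and_existsUnique_zero {K c a d e t₀ : ℝ} {F G : ℝ → ℝ} (hc : 0 ≤ c)
    (ha : 0 < a) (ha1 : a ≤ 1) (hd : 0 ≤ d) (he : 0 ≤ e) (ht₀ : 1 ≤ t₀)
    (hF : ∀ t, F t = K - t ^ 2 / (2 * t - 1) + c * (a ^ (t + d) - 1))
    (hG : ∀ t, G t = K - t ^ 2 / (2 * t - 1) + c * (a⁻¹ ^ (t + e) - 1)) (hpos : 0 < F t₀) :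
    StrictAntiOn (fun t => min (F t) (G t)) (Ici t₀) ∧
      ∃! T : ℝ, T ∈ Ioi t₀ ∧ min (F T) (G T) = 0 := by
  have hmin : ∀ t, t₀ ≤ t → min (F t) (G t) = F t := fun t ht => by
    have h1 : a ^ (t + d) ≤ 1 := rpow_le_one ha.le ha1 (by linarith)
    have h2 : 1 ≤ a⁻¹ ^ (t + e) := one_le_rpow (one_le_inv_iff₀.2 ⟨ha, ha1⟩) (by linarith)
    rw [min_eq_left_iff, hF, hG]
    gcongr
    exact h1.trans h2
  have hanti : StrictAntiOn (fun t => min (F t) (G t)) (Ici t₀) := by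
    have h := (strictAntiOn_sub_sq_div_add_rpow (K := K) d hc ha ha1).mono (Ici_subset_Ici.2 ht₀)
    refine h.congr fun t ht => ?_
    exact ((hmin t ht).trans (hF t)).symm
  refine ⟨hanti, ?_⟩
  rw [hF] at hpos
  obtain ⟨T, hT, hT0⟩ := exists_zero_sub_sq_div_add_rpow hc ha ha1 hd ht₀ hpos
  refine ⟨T, ⟨hT, by rw [hmin T hT.le, hF, hT0]⟩, fun S hS => ?_⟩
  refine hanti.injOn (mem_Ici.2 (le_of_lt hS.1)) (mem_Ici.2 hT.le) ?_
  exact hS.2.trans ((hmin T hT.le).trans ((hF T).trans hT0)).symm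

/-- Monotonicity and existence of a unique root `T` for
`t ↦ min{I_{p,q,λ,γ}(t), I_{q,p,γ,λ}(t)}` beyond `t₀ = max{t₊(p−1), t₊(q−1)}`,
provided both quantities are positive at `t₀`. -/
theorem stmt_19 (p q lam gam : ℝ) (hp : 2 < p) (hq : 2 < q)
    (hlam : 0 < lam) (hgam : 0 < gam)
    (I₁ I₂ : ℝ → ℝ)
    (hI₁ : ∀ t : ℝ, I₁ t = p + q - 1 - t ^ 2 / (2 * t - 1)
      + (2 * p * q / (p + q)) * ((gam * q / (lam * p)) ^ (t + q - 1) - 1))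
    (hI₂ : ∀ t : ℝ, I₂ t = p + q - 1 - t ^ 2 / (2 * t - 1)
      + (2 * p * q / (p + q)) * ((lam * p / (gam * q)) ^ (t + p - 1) - 1))
    (t₀ : ℝ)
    (ht₀ : t₀ = max ((p - 1) + Real.sqrt ((p - 1) * (p - 2)))
      ((q - 1) + Real.sqrt ((q - 1) * (q - 2))))
    (hpos₁ : 0 < I₁ t₀) (hpos₂ : 0 < I₂ t₀) :
    StrictAntiOn (fun t => min (I₁ t) (I₂ t)) (Set.Ici t₀) ∧
      ∃! T : ℝ, T ∈ Set.Ioi t₀ ∧ min (I₁ T) (I₂ T) = 0 := by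
  have hc : 0 ≤ 2 * p * q / (p + q) := by positivity
  have ha : 0 < gam * q / (lam * p) := by positivity
  have hb : 0 < lam * p / (gam * q) := by positivity
  have hab : lam * p / (gam * q) = (gam * q / (lam * p))⁻¹ := (inv_div _ _).symm
  have hba : gam * q / (lam * p) = (lam * p / (gam * q))⁻¹ := (inv_div _ _).symm
  have h1 : 1 ≤ t₀ := by
    rw [ht₀]
    exact le_max_of_le_left (by linarith [Real.sqrt_nonneg ((p - 1) * (p - 2))])
  simp only [add_sub_assoc _ q 1, add_sub_assoc _ p 1] at hI₁ hI₂
  rcases le_total (gam * q / (lam * p)) 1 with h | h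
  · rw [hab] at hI₂
    exact min_strictAntiOn_and_existsUnique_zero hc ha h (by linarith) (by linarith) h1 hI₁ hI₂
      hpos₁
  · have h' : lam * p / (gam * q) ≤ 1 := by
      rw [hab]
      exact inv_le_one_of_one_le₀ h
    rw [hba] at hI₁
    simp only [min_comm (I₁ _)]
    exact min_strictAntiOn_and_existsUnique_zero hc hb h' (by linarith) (by linarith) h1 hI₂ hI₁
      hpos₂
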